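/- arXiv:1208.4488 — 2 statements merged into one kernel-verified Lean document; each statement's English description precedes it below -/
import Mathlib

section
/- With the notation of the context, for 0 < s < 1/2 and 0 < t < 1/2 the following hold: (i) on the two-element subgroup K₁ = {E, SR³}, ω_{(s,s)}(SR³, SR³) = exp(−4πis) and all other values of ω_{(s,s)} on K₁ × K₁ equal 1; (ii) on K₂ = {E, SR²}, ω_{(0,t)}(SR², SR²) = exp(−2πit) and all other values of ω_{(0,t)} on K₂ × K₂ equal 1; (iii) on K₃ = {E, S}, ω_{(s,1/2)}(S, S) = exp(−2πis) and all other values of ω_{(s,1/2)} on K₃ × K₃ equal 1. -/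
noncomputable section
open Matrix

abbrev Mat2 : Type := Matrix (Fin 2) (Fin 2) ℝ

/-- The rotation `R` by `π/2` as a unit of the matrix ring. -/
def RU : Mat2ˣ where
  val := !![0, -1; 1, 0]
  inv := !![0, 1; -1, 0]
  val_inv := by rw [Matrix.one_fin_two]; norm_num [Matrix.mul_fin_two]
  inv_val := by rw [Matrix.one_fin_two]; norm_num [Matrix.mul_fin_two]

/-- The reflection `S` as a unit of the matrix ring. -/
def SU : Mat2ˣ where
  val := !![1, 0; 0, -1]
  inv := !![1, 0; 0, -1]
  val_inv := by rw [Matrix.one_fin_two]; norm_num [Matrix.mul_fin_two]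
  inv_val := by rw [Matrix.one_fin_two]; norm_num [Matrix.mul_fin_two]

/-- The semidirect product `M = ℝ² ⋊ GL₂(ℝ)`, with elements written `(a, X)` and
multiplication `(a, X)(b, Y) = (a + Xb, XY)`. -/
@[ext]
structure Motion : Type where
  tr : Fin 2 → ℝ
  mat : Mat2ˣ

namespace Motion

instance : Group Motion where
  mul p q := ⟨p.tr + p.mat.val.mulVec q.tr, p.mat * q.mat⟩
  one := ⟨0, 1⟩
  inv p := ⟨-((↑(p.mat⁻¹) : Mat2).mulVec p.tr), p.mat⁻¹⟩
  mul_assoc a b c := by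
    refine Motion.ext ?_ ?_
    · show (a.tr + a.mat.val.mulVec b.tr) + ((a.mat * b.mat).val).mulVec c.tr =
        a.tr + a.mat.val.mulVec (b.tr + b.mat.val.mulVec c.tr)
      rw [Matrix.mulVec_add, Units.val_mul, ← Matrix.mulVec_mulVec, add_assoc]
    · show a.mat * b.mat * c.mat = a.mat * (b.mat * c.mat)
      exact mul_assoc _ _ _
  one_mul a := by
    refine Motion.ext ?_ ?_
    · show (0 : Fin 2 → ℝ) + (1 : Mat2ˣ).val.mulVec a.tr = a.tr
      simp
    · show 1 * a.mat = a.mat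
      simp
  mul_one a := by
    refine Motion.ext ?_ ?_
    · show a.tr + a.mat.val.mulVec 0 = a.tr
      simp
    · show a.mat * 1 = a.mat
      simp
  inv_mul_cancel a := by
    refine Motion.ext ?_ ?_
    · show -((↑(a.mat⁻¹) : Mat2).mulVec a.tr) + (↑(a.mat⁻¹) : Mat2).mulVec a.tr = 0
      simp
    · show a.mat⁻¹ * a.mat = 1
      simp

end Motion

/-- The rotation subgroup `⟨R⟩ = {E, R, R², R³}` of `D₄`. -/
def rotSet : Set Mat2ˣ := {1, RU, RU ^ 2, RU ^ 3}

/-- The coset of reflections `S⟨R⟩ = {S, SR, SR², SR³}`. -/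
def refSet : Set Mat2ˣ := {SU, SU * RU, SU * RU ^ 2, SU * RU ^ 3}

/-- The dihedral group `D₄` of order 8 generated by `R` and `S`. -/
def D4set : Set Mat2ˣ := rotSet ∪ refSet

/-- The vector `v = (1/2, 1/2)`. -/
def vhalf : Fin 2 → ℝ := ![1/2, 1/2]


/-- The character `χ_z(n) = exp(2πi(z₁n₁ + z₂n₂))` of `ℝ²` (restricted to `ℤ²`). -/
def chiz (z n : Fin 2 → ℝ) : ℂ :=
  Complex.exp (2 * Real.pi * Complex.I * (z 0 * n 0 + z 1 * n 1))

/-- The subgroup `K₁ = {E, SR³}`. -/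
def K1set : Set Mat2ˣ := {1, SU * RU ^ 3}
/-- The subgroup `K₂ = {E, SR²}`. -/
def K2set : Set Mat2ˣ := {1, SU * RU ^ 2}
/-- The subgroup `K₃ = {E, S}`. -/
def K3set : Set Mat2ˣ := {1, SU}

theorem Motion.mul_tr (p q : Motion) : (p * q).tr = p.tr + p.mat.val.mulVec q.tr := rfl

theorem Motion.one_tr : (1 : Motion).tr = 0 := rfl

theorem Motion.mk_zero_one : (⟨0, 1⟩ : Motion) = 1 := rfl

/-- Over an involution `X`, the coboundary of a section through `(a, X)` is `-(a + Xa)`. -/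
theorem Motion.eq_neg_of_inv_mul_inv {a d : Fin 2 → ℝ} {X : Mat2ˣ}
    (h : (⟨a, X⟩ : Motion)⁻¹ * 1 * (⟨a, X⟩ : Motion)⁻¹ = ⟨d, 1⟩) :
    d = -(a + X.val.mulVec a) := by
  have h' : (⟨d, 1⟩ : Motion) * (⟨a, X⟩ * ⟨a, X⟩) = 1 := by
    rw [← h]
    group
  have h'' := congrArg Motion.tr h'
  simp only [Motion.mul_tr, Motion.one_tr, Units.val_one, Matrix.one_mulVec] at h''
  exact eq_neg_of_add_eq_zero_left h''

theorem chiz_zero (z : Fin 2 → ℝ) : chiz z 0 = 1 := by simp [chiz]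

theorem mulVec_vhalf (a b c d : ℝ) :
    !![a, b; c, d].mulVec vhalf = ![(a + b) / 2, (c + d) / 2] := by
  ext i
  fin_cases i <;> simp [vhalf, Matrix.mulVec, dotProduct, Fin.sum_univ_two] <;> ring

theorem val_SU_mul_RU_sq : (SU * RU ^ 2).val = !![-1, 0; 0, 1] := by
  simp [SU, RU, pow_succ]

theorem val_SU_mul_RU_cube : (SU * RU ^ 3).val = !![0, 1; 1, 0] := by
  simp [SU, RU, pow_succ]

theorem SU_mul_self : SU * SU = 1 := by
  ext1
  simp [SU, Matrix.one_fin_two]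

theorem SU_mul_RU_sq_mul_self : SU * RU ^ 2 * (SU * RU ^ 2) = 1 := by
  ext1
  rw [Units.val_mul, val_SU_mul_RU_sq]
  simp [Matrix.one_fin_two]

theorem SU_mul_RU_cube_mul_self : SU * RU ^ 3 * (SU * RU ^ 3) = 1 := by
  ext1
  rw [Units.val_mul, val_SU_mul_RU_cube]
  simp [Matrix.one_fin_two]

/-- Values of the Mackey obstruction cocycles
`ω_z(X,Y) = χ_z(∂c(X,Y))` on the stabilizers `K₁, K₂, K₃` along the edges of the
fundamental domain. -/
theorem stmt_10
    (c : Mat2ˣ → Motion)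
    (hcR : ∀ X ∈ rotSet, c X = ⟨0, X⟩)
    (hcS : ∀ X ∈ refSet, c X = ⟨vhalf, X⟩)
    (dc : Mat2ˣ → Mat2ˣ → (Fin 2 → ℝ))
    (hdc : ∀ X ∈ D4set, ∀ Y ∈ D4set, (c X)⁻¹ * c (X * Y) * (c Y)⁻¹ = ⟨dc X Y, 1⟩)
    (s t : ℝ) (hs0 : 0 < s) (hs : s < 1/2) (ht0 : 0 < t) (ht : t < 1/2) :
    (chiz ![s, s] (dc (SU * RU ^ 3) (SU * RU ^ 3)) =
        Complex.exp (-(4 * Real.pi * Complex.I * s)) ∧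
      ∀ X ∈ K1set, ∀ Y ∈ K1set, ¬(X = SU * RU ^ 3 ∧ Y = SU * RU ^ 3) →
        chiz ![s, s] (dc X Y) = 1) ∧
    (chiz ![0, t] (dc (SU * RU ^ 2) (SU * RU ^ 2)) =
        Complex.exp (-(2 * Real.pi * Complex.I * t)) ∧
      ∀ X ∈ K2set, ∀ Y ∈ K2set, ¬(X = SU * RU ^ 2 ∧ Y = SU * RU ^ 2) →
        chiz ![0, t] (dc X Y) = 1) ∧
    (chiz ![s, 1/2] (dc SU SU) =
        Complex.exp (-(2 * Real.pi * Complex.I * s)) ∧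
      ∀ X ∈ K3set, ∀ Y ∈ K3set, ¬(X = SU ∧ Y = SU) →
        chiz ![s, 1/2] (dc X Y) = 1) := by
  have one_mem : (1 : Mat2ˣ) ∈ rotSet := by simp [rotSet]
  have c_one : c 1 = 1 := by rw [hcR 1 one_mem, Motion.mk_zero_one]
  have dc_one_left : ∀ Y ∈ D4set, dc 1 Y = 0 := by
    intro Y hY
    have h := congrArg Motion.tr (hdc 1 (Or.inl one_mem) Y hY)
    simpa [c_one, Motion.one_tr] using h.symm
  have dc_one_right : ∀ X ∈ D4set, dc X 1 = 0 := by
    intro X hX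
    have h := congrArg Motion.tr (hdc X hX 1 (Or.inl one_mem))
    simpa [c_one, Motion.one_tr] using h.symm
  have dc_self : ∀ X ∈ refSet, X * X = 1 → dc X X = -(vhalf + X.val.mulVec vhalf) := by
    intro X hX hXX
    have h := hdc X (Or.inr hX) X (Or.inr hX)
    rw [hXX, c_one, hcS X hX] at h
    exact Motion.eq_neg_of_inv_mul_inv h
  have trivial_off_diagonal : ∀ A ∈ refSet, ∀ z, ∀ X ∈ ({1, A} : Set Mat2ˣ),
      ∀ Y ∈ ({1, A} : Set Mat2ˣ), ¬(X = A ∧ Y = A) → chiz z (dc X Y) = 1 := by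
    rintro A hA z X (rfl | rfl) Y (rfl | rfl) hXY
    · rw [dc_one_left 1 (Or.inl one_mem), chiz_zero]
    · rw [dc_one_left _ (Or.inr hA), chiz_zero]
    · rw [dc_one_right _ (Or.inr hA), chiz_zero]
    · exact absurd ⟨rfl, rfl⟩ hXY
  have mem_cube : SU * RU ^ 3 ∈ refSet := by simp [refSet]
  have mem_sq : SU * RU ^ 2 ∈ refSet := by simp [refSet]
  have mem_S : SU ∈ refSet := by simp [refSet]
  refine ⟨⟨?_, trivial_off_diagonal _ mem_cube _⟩, ⟨?_, trivial_off_diagonal _ mem_sq _⟩,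
    ⟨?_, trivial_off_diagonal _ mem_S _⟩⟩
  · rw [dc_self _ mem_cube SU_mul_RU_cube_mul_self, val_SU_mul_RU_cube, chiz]
    congr 1
    simp only [mulVec_vhalf]
    simp [vhalf]
    ring
  · rw [dc_self _ mem_sq SU_mul_RU_sq_mul_self, val_SU_mul_RU_sq, chiz]
    congr 1
    simp only [mulVec_vhalf]
    simp [vhalf]
    ring
  · rw [dc_self _ mem_S SU_mul_self, show SU.val = !![1, 0; 0, -1] from rfl, chiz]
    congr 1
    simp only [mulVec_vhalf]
    simp [vhalf]
    ring
end
end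

section
/- Let H = {E, R², S, SR²} be the subgroup of D₄ indicated in the context, and let ω : H × H → {1,−1} be defined by ω(X,Y) = −1 if X ∈ {R², SR²} and Y ∈ {S, SR²}, and ω(X,Y) = 1 otherwise. Let C₂ = {1,−1} ⊆ ℝ with multiplication. Then: (i) the operation (X,u)(Y,w) = (XY, ω(X,Y)·u·w) makes H × C₂ into a group with identity (E,1); and (ii) there is a group isomorphism φ : D₄ → H × C₂ (with this twisted multiplication) satisfying φ(R) = (SR², 1) and φ(S) = (R², 1). -/
noncomputable section
open Matrix

/-- The dihedral group `D₄`, i.e. the subgroup of `GL₂(ℝ)` generated by `R` and `S`. -/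
def D4sub : Subgroup Mat2ˣ := Subgroup.closure {RU, SU}

/-- The subgroup `H = {E, R², S, SR²}` of `D₄`. -/
def Hset : Set Mat2ˣ := {1, RU ^ 2, SU, SU * RU ^ 2}

/-- The two-element set `C₂ = {1, -1} ⊆ ℝ`. -/
abbrev C2t : Type := {x : ℝ // x = 1 ∨ x = -1}

/-- The underlying set `H × C₂` of the twisted product group. -/
def Tw : Type := Hset × C2t

theorem coe_RU : (RU : Mat2) = !![0, -1; 1, 0] := rfl

theorem coe_SU : (SU : Mat2) = !![1, 0; 0, -1] := rfl

theorem coe_RU_sq : ((RU ^ 2 : Mat2ˣ) : Mat2) = !![-1, 0; 0, -1] := by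
  simp [sq, coe_RU]

theorem coe_SU_mul_RU_sq : ((SU * RU ^ 2 : Mat2ˣ) : Mat2) = !![-1, 0; 0, 1] := by
  rw [Units.val_mul, coe_RU_sq, coe_SU]
  simp

/-- The diagonal entries of the elements of `H` are arbitrary signs. -/
theorem mem_Hset_iff (X : Mat2ˣ) :
    X ∈ Hset ↔ ∃ a b : ℝ, (a = 1 ∨ a = -1) ∧ (b = 1 ∨ b = -1) ∧ (X : Mat2) = !![a, 0; 0, b] := by
  have hone : ((1 : Mat2ˣ) : Mat2) = !![1, 0; 0, 1] := by simp [Matrix.one_fin_two]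
  constructor
  · rintro (rfl | rfl | rfl | rfl)
    · exact ⟨1, 1, by simp, by simp, hone⟩
    · exact ⟨-1, -1, by simp, by simp, coe_RU_sq⟩
    · exact ⟨1, -1, by simp, by simp, rfl⟩
    · exact ⟨-1, 1, by simp, by simp, coe_SU_mul_RU_sq⟩
  · rintro ⟨a, b, rfl | rfl, rfl | rfl, h⟩
    · exact Or.inl (Units.ext (h.trans hone.symm))
    · exact Or.inr (Or.inr (Or.inl (Units.ext h)))
    · exact Or.inr (Or.inr (Or.inr (Units.ext (h.trans coe_SU_mul_RU_sq.symm))))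
    · exact Or.inr (Or.inl (Units.ext (h.trans coe_RU_sq.symm)))

/-- The diagonal matrix with entries `a`, `b` lies in `{R², SR²}` exactly when `a = -1`. -/
theorem mem_RU_sq_SU_mul_RU_sq_iff {X : Mat2ˣ} {a b : ℝ} (hb : b = 1 ∨ b = -1)
    (hX : (X : Mat2) = !![a, 0; 0, b]) :
    X ∈ ({RU ^ 2, SU * RU ^ 2} : Set Mat2ˣ) ↔ a = -1 := by
  simp only [Set.mem_insert_iff, Set.mem_singleton_iff, Units.ext_iff, hX, coe_RU_sq,
    coe_SU_mul_RU_sq, ← Matrix.ext_iff, Fin.forall_fin_two]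
  simp
  tauto

/-- The diagonal matrix with sign entries `a`, `b` lies in `{S, SR²}` exactly when `ab = -1`. -/
theorem mem_SU_SU_mul_RU_sq_iff {X : Mat2ˣ} {a b : ℝ} (ha : a = 1 ∨ a = -1)
    (hb : b = 1 ∨ b = -1) (hX : (X : Mat2) = !![a, 0; 0, b]) :
    X ∈ ({SU, SU * RU ^ 2} : Set Mat2ˣ) ↔ a * b = -1 := by
  simp only [Set.mem_insert_iff, Set.mem_singleton_iff, Units.ext_iff, hX, coe_SU,
    coe_SU_mul_RU_sq, ← Matrix.ext_iff, Fin.forall_fin_two]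
  rcases ha with rfl | rfl <;> rcases hb with rfl | rfl <;> norm_num

/-- The cocycle `ω` on diagonal matrices with diagonals `(a, b)` and `(c, d)`. -/
def signCocycle (a c d : ℝ) : ℝ := (1 + a + c * d - a * c * d) / 2

theorem signCocycle_eq_one_or {a c d : ℝ} (ha : a = 1 ∨ a = -1) (hc : c = 1 ∨ c = -1)
    (hd : d = 1 ∨ d = -1) : signCocycle a c d = 1 ∨ signCocycle a c d = -1 := by
  unfold signCocycle
  rcases ha with rfl | rfl <;> rcases hc with rfl | rfl <;> rcases hd with rfl | rfl <;> norm_num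

theorem mul_eq_one_or {x y : ℝ} (hx : x = 1 ∨ x = -1) (hy : y = 1 ∨ y = -1) :
    x * y = 1 ∨ x * y = -1 := by
  rcases hx with rfl | rfl <;> rcases hy with rfl | rfl <;> norm_num

/-- The element of `D₄` corresponding to `(diag(a, b), u)` in the twisted product. -/
def twistMatrix (a b u : ℝ) : Mat2 :=
  !![u * (1 + a * b) / 2, u * (a - b) / 2; u * (1 - a * b) / 2, u * (a + b) / 2]

theorem twistMatrix_mul {a b c d : ℝ} (u w : ℝ) (ha : a = 1 ∨ a = -1) (hb : b = 1 ∨ b = -1)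
    (hc : c = 1 ∨ c = -1) (hd : d = 1 ∨ d = -1) :
    twistMatrix a b u * twistMatrix c d w =
      twistMatrix (a * c) (b * d) (signCocycle a c d * u * w) := by
  unfold twistMatrix signCocycle
  rw [Matrix.mul_fin_two]
  rcases ha with rfl | rfl <;> rcases hb with rfl | rfl <;> rcases hc with rfl | rfl <;>
    rcases hd with rfl | rfl <;> norm_num <;> grind

theorem twistMatrix_injective {a b c d u w : ℝ} (hu : u = 1 ∨ u = -1)
    (h : twistMatrix a b u = twistMatrix c d w) :
    a = c ∧ b = d ∧ u = w := by
  simp only [twistMatrix, ← Matrix.ext_iff, Fin.forall_fin_two] at h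
  simp at h
  obtain ⟨⟨h1, h2⟩, h3, h4⟩ := h
  have huw : u = w := by linarith
  subst huw
  rcases hu with rfl | rfl <;> exact ⟨by linarith, by linarith, rfl⟩

theorem exists_mem_D4sub_eq_twistMatrix {a b u : ℝ} (ha : a = 1 ∨ a = -1) (hb : b = 1 ∨ b = -1)
    (hu : u = 1 ∨ u = -1) : ∃ g ∈ D4sub, (g : Mat2) = twistMatrix a b u := by
  have hR : RU ∈ D4sub := Subgroup.subset_closure (by simp)
  have hS : SU ∈ D4sub := Subgroup.subset_closure (by simp)
  have hneg : ∃ g ∈ D4sub, (g : Mat2) = !![u, 0; 0, u] := by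
    rcases hu with rfl | rfl
    · exact ⟨1, one_mem _, by simp [Matrix.one_fin_two]⟩
    · exact ⟨RU ^ 2, pow_mem hR 2, coe_RU_sq⟩
  obtain ⟨n, hn, hnu⟩ := hneg
  rcases ha with rfl | rfl <;> rcases hb with rfl | rfl
  · exact ⟨n, hn, by norm_num [hnu, twistMatrix]⟩
  · exact ⟨n * (RU * SU), mul_mem hn (mul_mem hR hS), by
      norm_num [hnu, coe_RU, coe_SU, twistMatrix, Matrix.mul_fin_two, neg_div]⟩
  · exact ⟨n * RU, mul_mem hn hR, by
      norm_num [hnu, coe_RU, twistMatrix, Matrix.mul_fin_two, neg_div]⟩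
  · exact ⟨n * SU, mul_mem hn hS, by
      norm_num [hnu, coe_SU, twistMatrix, Matrix.mul_fin_two, neg_div]⟩

/-- The multiplication `(X,u)(Y,w) = (XY, ω(X,Y)·u·w)` makes `H × C₂`
into a group with identity `(E, 1)`, and `D₄` is isomorphic to this group via an
isomorphism `φ` with `φ(R) = (SR², 1)` and `φ(S) = (R², 1)`. -/
theorem stmt_13
    (ω : Mat2ˣ → Mat2ˣ → ℝ)
    (hω_neg : ∀ X Y, X ∈ ({RU ^ 2, SU * RU ^ 2} : Set Mat2ˣ) →
      Y ∈ ({SU, SU * RU ^ 2} : Set Mat2ˣ) → ω X Y = -1)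
    (hω_pos : ∀ X Y, ¬(X ∈ ({RU ^ 2, SU * RU ^ 2} : Set Mat2ˣ) ∧
      Y ∈ ({SU, SU * RU ^ 2} : Set Mat2ˣ)) → ω X Y = 1) :
    ∃ (mul : Tw → Tw → Tw) (e : Tw),
      (∀ p q : Tw, ((mul p q).1 : Mat2ˣ) = ↑p.1 * ↑q.1 ∧
        ((mul p q).2 : ℝ) = ω ↑p.1 ↑q.1 * ↑p.2 * ↑q.2) ∧
      ((e.1 : Mat2ˣ) = 1 ∧ (e.2 : ℝ) = 1) ∧
      (∀ a b c : Tw, mul (mul a b) c = mul a (mul b c)) ∧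
      (∀ a : Tw, mul e a = a ∧ mul a e = a) ∧
      (∀ a : Tw, ∃ b : Tw, mul a b = e ∧ mul b a = e) ∧
      ∃ φ : D4sub → Tw,
        Function.Bijective φ ∧
        (∀ a b : D4sub, φ (a * b) = mul (φ a) (φ b)) ∧
        ((φ ⟨RU, Subgroup.subset_closure (by simp)⟩).1 : Mat2ˣ) = SU * RU ^ 2 ∧
        ((φ ⟨RU, Subgroup.subset_closure (by simp)⟩).2 : ℝ) = 1 ∧
        ((φ ⟨SU, Subgroup.subset_closure (by simp)⟩).1 : Mat2ˣ) = RU ^ 2 ∧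
        ((φ ⟨SU, Subgroup.subset_closure (by simp)⟩).2 : ℝ) = 1 := by
  have hωval : ∀ {X Y : Mat2ˣ} {a b c d : ℝ}, (a = 1 ∨ a = -1) → (b = 1 ∨ b = -1) →
      (c = 1 ∨ c = -1) → (d = 1 ∨ d = -1) → (X : Mat2) = !![a, 0; 0, b] →
      (Y : Mat2) = !![c, 0; 0, d] → ω X Y = signCocycle a c d := by
    intro X Y a b c d ha hb hc hd hX hY
    have h1 := mem_RU_sq_SU_mul_RU_sq_iff hb hX
    have h2 := mem_SU_SU_mul_RU_sq_iff hc hd hY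
    by_cases h : a = -1 ∧ c * d = -1
    · rw [hω_neg X Y (h1.2 h.1) (h2.2 h.2), signCocycle, mul_assoc, h.1, h.2]
      norm_num
    · rw [hω_pos X Y (by rwa [h1, h2]), signCocycle]
      rcases ha with rfl | rfl
      · ring
      · have : c * d = 1 := (mul_eq_one_or hc hd).resolve_right fun h' => h ⟨rfl, h'⟩
        linarith
  choose α β hα hβ hαβ using fun p : Tw => (mem_Hset_iff p.1).1 p.1.2
  have tw_ext : ∀ p q : Tw, α p = α q → β p = β q → (p.2 : ℝ) = q.2 → p = q := by
    intro p q h1 h2 h3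
    refine Prod.ext (Subtype.ext (Units.ext ?_)) (Subtype.ext h3)
    rw [hαβ, hαβ, h1, h2]
  have coord_eq : ∀ (p : Tw) {a b : ℝ}, ((p.1 : Mat2ˣ) : Mat2) = !![a, 0; 0, b] →
      α p = a ∧ β p = b := by
    intro p a b h
    rw [hαβ] at h
    exact ⟨congrFun (congrFun h 0) 0, congrFun (congrFun h 1) 1⟩
  have hω : ∀ p q : Tw, ω p.1 q.1 = signCocycle (α p) (α q) (β q) := fun p q =>
    hωval (hα p) (hβ p) (hα q) (hβ q) (hαβ p) (hαβ q)
  have coe_mul : ∀ p q : Tw, (((p.1 : Mat2ˣ) * q.1 : Mat2ˣ) : Mat2) =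
      !![α p * α q, 0; 0, β p * β q] := by
    intro p q
    rw [Units.val_mul, hαβ, hαβ, Matrix.mul_fin_two]
    simp
  have ω_sign : ∀ p q : Tw, ω p.1 q.1 = 1 ∨ ω p.1 q.1 = -1 := fun p q => by
    rw [hω]
    exact signCocycle_eq_one_or (hα p) (hα q) (hβ q)
  let mul : Tw → Tw → Tw := fun p q =>
    (⟨p.1 * q.1, (mem_Hset_iff _).2 ⟨_, _, mul_eq_one_or (hα p) (hα q),
      mul_eq_one_or (hβ p) (hβ q), coe_mul p q⟩⟩,
     ⟨ω p.1 q.1 * p.2 * q.2, mul_eq_one_or (mul_eq_one_or (ω_sign p q) p.2.2) q.2.2⟩)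
  let e : Tw := (⟨1, Or.inl rfl⟩, ⟨1, Or.inl rfl⟩)
  let inv : Tw → Tw := fun p =>
    (p.1, ⟨ω p.1 p.1 * p.2, mul_eq_one_or (ω_sign p p) p.2.2⟩)
  choose ψ hψ_mem hψ using fun p : Tw =>
    exists_mem_D4sub_eq_twistMatrix (hα p) (hβ p) p.2.2
  have ψ_inj : Function.Injective ψ := by
    intro p q h
    have h' : twistMatrix (α p) (β p) p.2 = twistMatrix (α q) (β q) q.2 := by
      rw [← hψ, ← hψ, h]
    obtain ⟨h1, h2, h3⟩ := twistMatrix_injective p.2.2 h'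
    exact tw_ext p q h1 h2 h3
  have ψ_mul : ∀ p q, ψ (mul p q) = ψ p * ψ q := by
    intro p q
    obtain ⟨h1, h2⟩ := coord_eq (mul p q) (coe_mul p q)
    refine Units.ext ?_
    rw [Units.val_mul, hψ, hψ, hψ, h1, h2, twistMatrix_mul _ _ (hα p) (hβ p) (hα q) (hβ q),
      ← hω]
  have ψ_of_coord : ∀ (p : Tw) {a b : ℝ} {g : Mat2ˣ}, ((p.1 : Mat2ˣ) : Mat2) = !![a, 0; 0, b] →
      (g : Mat2) = twistMatrix a b p.2 → ψ p = g := by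
    intro p a b g hp hg
    obtain ⟨h1, h2⟩ := coord_eq p hp
    exact Units.ext (by rw [hψ, h1, h2, hg])
  have ψ_e : ψ e = 1 :=
    ψ_of_coord e (a := 1) (b := 1) Matrix.one_fin_two
      (Matrix.one_fin_two.trans (by norm_num [e, twistMatrix]))
  have mul_inv : ∀ p, mul p (inv p) = e := by
    intro p
    refine Prod.ext (Subtype.ext (Units.ext ?_)) (Subtype.ext ?_)
    · change (((p.1 : Mat2ˣ) * p.1 : Mat2ˣ) : Mat2) = ((1 : Mat2ˣ) : Mat2)
      rw [coe_mul, Units.val_one, Matrix.one_fin_two, mul_self_eq_one_iff.2 (hα p),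
        mul_self_eq_one_iff.2 (hβ p)]
    · change ω p.1 p.1 * p.2 * (ω p.1 p.1 * p.2) = (1 : ℝ)
      exact mul_self_eq_one_iff.2 (mul_eq_one_or (ω_sign p p) p.2.2)
  have ψ_inv : ∀ p, ψ (inv p) = (ψ p)⁻¹ := fun p =>
    eq_inv_of_mul_eq_one_right (by rw [← ψ_mul, mul_inv, ψ_e])
  let r : Tw := (⟨SU * RU ^ 2, by simp [Hset]⟩, ⟨1, Or.inl rfl⟩)
  let s : Tw := (⟨RU ^ 2, by simp [Hset]⟩, ⟨1, Or.inl rfl⟩)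
  have ψ_r : ψ r = RU :=
    ψ_of_coord r coe_SU_mul_RU_sq (by norm_num [r, twistMatrix, coe_RU])
  have ψ_s : ψ s = SU :=
    ψ_of_coord s coe_RU_sq (by norm_num [s, twistMatrix, coe_SU])
  have ψ_surj : ∀ g ∈ D4sub, ∃ p, ψ p = g := by
    intro g hg
    induction hg using Subgroup.closure_induction with
    | mem x hx =>
      rcases hx with rfl | rfl
      exacts [⟨r, ψ_r⟩, ⟨s, ψ_s⟩]
    | one => exact ⟨e, ψ_e⟩
    | mul x y _ _ hx hy =>
      obtain ⟨p, rfl⟩ := hx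
      obtain ⟨q, rfl⟩ := hy
      exact ⟨mul p q, ψ_mul p q⟩
    | inv x _ hx =>
      obtain ⟨p, rfl⟩ := hx
      exact ⟨inv p, ψ_inv p⟩
  choose φ hφ using fun g : D4sub => ψ_surj g g.2
  have φ_r : φ ⟨RU, Subgroup.subset_closure (by simp)⟩ = r := ψ_inj ((hφ _).trans ψ_r.symm)
  have φ_s : φ ⟨SU, Subgroup.subset_closure (by simp)⟩ = s := ψ_inj ((hφ _).trans ψ_s.symm)
  refine ⟨mul, e, fun p q => ⟨rfl, rfl⟩, ⟨rfl, rfl⟩, fun a b c => ψ_inj ?_,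
    fun a => ⟨ψ_inj ?_, ψ_inj ?_⟩, fun a => ⟨inv a, mul_inv a, ψ_inj ?_⟩, φ, ⟨fun g h hgh => ?_,
    fun p => ⟨⟨ψ p, hψ_mem p⟩, ψ_inj (hφ _)⟩⟩, fun a b => ψ_inj ?_, ?_, ?_, ?_, ?_⟩
  · simp only [ψ_mul, mul_assoc]
  · rw [ψ_mul, ψ_e, one_mul]
  · rw [ψ_mul, ψ_e, mul_one]
  · rw [ψ_mul, ψ_inv, ψ_e, inv_mul_cancel]
  · exact Subtype.ext (by rw [← hφ g, ← hφ h, hgh])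
  · rw [ψ_mul, hφ, hφ, hφ, Subgroup.coe_mul]
  all_goals first | rw [φ_r] | rw [φ_s]
end
end
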